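/- (Pessimistic MDP lower-bounds the true value up to hitting time; step in the proof of Theorem 1.) Let M be an MDP with rewards in [−Rmax, Rmax] and discount γ ∈ [0,1), let U ⊆ S × A be any set of state-action pairs, and let M_p be the (U, Rmax)-true-dynamics pessimistic MDP: from any (s,a) ∈ U and from the absorbing state HALT every action leads to HALT with probability 1, from all other pairs transitions follow the true kernel P(·|s,a), the reward is −Rmax at HALT and r(s,a) otherwise, and the initial distribution is ρ0. Then for any policy π: J_{ρ0}(π, M_p) ≥ J_{ρ0}(π, M) − (2·Rmax/(1−γ))·E[γ^{T_U^π}], where T_U^π is the hitting time of U by π on M. -/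

import Mathlib

open scoped ENNReal NNReal
open Classical

namespace MOReL

universe u v

variable {S : Type u} {A : Type v}

/-- Distribution over trajectory prefixes `(s_0,a_0),…,(s_n,a_n)` generated by executing
policy `π` in the MDP with transition kernel `P` starting from `ρ0`. -/
noncomputable def pathPMF (ρ0 : PMF S) (π : S → PMF A) (P : S → A → PMF S) :
    (n : ℕ) → PMF (Fin (n + 1) → S × A)
  | 0 => ρ0.bind fun s => (π s).map fun a => fun _ => (s, a)
  | n + 1 =>
      (pathPMF ρ0 π P n).bind fun p =>
        (P (p (Fin.last n)).1 (p (Fin.last n)).2).bind fun s' =>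
          (π s').map fun a' => Fin.snoc p (s', a')

/-- Marginal distribution of `(s_t, a_t)`. -/
noncomputable def saDist (ρ0 : PMF S) (π : S → PMF A) (P : S → A → PMF S) (t : ℕ) :
    PMF (S × A) :=
  (pathPMF ρ0 π P t).map fun p => p (Fin.last t)

/-- Expectation of a real-valued function under a PMF. -/
noncomputable def pexp {α : Type*} (μ : PMF α) (f : α → ℝ) : ℝ :=
  ∑' x, (μ x).toReal * f x

/-- The value `J_{ρ0}(π, M) = E[∑_t γ^t r(s_t,a_t)]`. -/
noncomputable def J (ρ0 : PMF S) (π : S → PMF A) (P : S → A → PMF S) (γ : ℝ)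
    (r : S → A → ℝ) : ℝ :=
  ∑' t : ℕ, γ ^ t * pexp (saDist ρ0 π P t) (fun sa => r sa.1 sa.2)

/-- `P(T_V^π = t)`: the probability that the first visit of the executed trajectory to the
state-action set `V` occurs at time `t`. -/
noncomputable def hitProb (ρ0 : PMF S) (π : S → PMF A) (P : S → A → PMF S)
    (V : Set (S × A)) (t : ℕ) : ℝ≥0∞ :=
  (pathPMF ρ0 π P t).toOuterMeasure
    {p | p (Fin.last t) ∈ V ∧ ∀ i : Fin (t + 1), (i : ℕ) < t → p i ∉ V}

/-- `E[γ^{T_V^π}]`, with the convention `γ^∞ = 0`. -/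
noncomputable def discHit (ρ0 : PMF S) (π : S → PMF A) (P : S → A → PMF S) (γ : ℝ)
    (V : Set (S × A)) : ℝ :=
  ∑' t : ℕ, γ ^ t * (hitProb ρ0 π P V t).toReal

/-- Total variation distance between two PMFs. -/
noncomputable def DTV {α : Type*} (p q : PMF α) : ℝ :=
  (1 / 2) * ∑' x, |(p x).toReal - (q x).toReal|

/-- Discounted state-action visitation distribution `d^{π,M}(s,a)`. -/
noncomputable def dVisit (ρ0 : PMF S) (π : S → PMF A) (P : S → A → PMF S) (γ : ℝ)
    (sa : S × A) : ℝ :=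
  (1 - γ) * ∑' t : ℕ, γ ^ t * ((saDist ρ0 π P t) sa).toReal

/-- `d^{π,M}(V)` for a set `V` of state-action pairs. -/
noncomputable def dVisitSet (ρ0 : PMF S) (π : S → PMF A) (P : S → A → PMF S) (γ : ℝ)
    (V : Set (S × A)) : ℝ :=
  ∑' sa : V, dVisit ρ0 π P γ sa

/-- The set of `α`-unknown state-action pairs. -/
def unknown (P Phat : S → A → PMF S) (α : ℝ) : Set (S × A) :=
  {sa | α < DTV (Phat sa.1 sa.2) (P sa.1 sa.2)}

/-- Transition kernel of the pessimistic MDP on `Option S` (`none` is the absorbing state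
HALT): unknown pairs and HALT transition to HALT, known pairs follow `Phat`. -/
noncomputable def pessKernel (Phat : S → A → PMF S) (U : Set (S × A)) :
    Option S → A → PMF (Option S) := fun s a =>
  match s with
  | none => PMF.pure none
  | some s => if (s, a) ∈ U then PMF.pure none else (Phat s a).map some

/-- Reward of the pessimistic MDP: `-κ` at HALT and `r` elsewhere. -/
def pessReward (r : S → A → ℝ) (κ : ℝ) : Option S → A → ℝ := fun s a =>
  match s with
  | none => -κ
  | some s => r s a

/-- Extend a policy on `S` to `Option S` by an arbitrary action distribution at HALT
(the pessimistic value does not depend on this choice). -/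
def extendPolicy (π : S → PMF A) (a0 : PMF A) : Option S → PMF A := fun s =>
  match s with
  | none => a0
  | some s => π s

end MOReL

namespace MOReL

/-- Expectation of an `ℝ≥0∞`-valued function under a PMF. -/
noncomputable def lexp {α : Type*} (μ : PMF α) (f : α → ℝ≥0∞) : ℝ≥0∞ :=
  ∑' x, μ x * f x

lemma lexp_bind {α β : Type*} (μ : PMF α) (k : α → PMF β) (f : β → ℝ≥0∞) :
    lexp (μ.bind k) f = lexp μ fun x => lexp (k x) f := by
  simp only [lexp, PMF.bind_apply, ← ENNReal.tsum_mul_right, ← ENNReal.tsum_mul_left]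
  rw [ENNReal.tsum_comm]
  simp only [mul_assoc]

lemma lexp_pure {α : Type*} (x : α) (f : α → ℝ≥0∞) : lexp (PMF.pure x) f = f x := by
  rw [lexp, tsum_eq_single x]
  · simp
  · intro y hy
    simp [PMF.pure_apply, hy]

lemma lexp_map {α β : Type*} (μ : PMF α) (g : α → β) (f : β → ℝ≥0∞) :
    lexp (μ.map g) f = lexp μ fun x => f (g x) := by
  rw [PMF.map, lexp_bind]
  simp only [Function.comp_apply, lexp_pure]

lemma lexp_const {α : Type*} (μ : PMF α) (c : ℝ≥0∞) : lexp μ (fun _ => c) = c := by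
  simp [lexp, ENNReal.tsum_mul_right, PMF.tsum_coe]

lemma lexp_add {α : Type*} (μ : PMF α) (f g : α → ℝ≥0∞) :
    lexp μ (fun x => f x + g x) = lexp μ f + lexp μ g := by
  simp only [lexp, mul_add, ENNReal.tsum_add]

lemma lexp_mono {α : Type*} (μ : PMF α) {f g : α → ℝ≥0∞} (h : ∀ x, f x ≤ g x) :
    lexp μ f ≤ lexp μ g :=
  ENNReal.tsum_le_tsum fun x => mul_le_mul_right (h x) _

lemma lexp_const_mul {α : Type*} (μ : PMF α) (c : ℝ≥0∞) (f : α → ℝ≥0∞) :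
    lexp μ (fun x => c * f x) = c * lexp μ f := by
  simp only [lexp, ← ENNReal.tsum_mul_left, mul_left_comm]

lemma summable_toReal {α : Type*} (μ : PMF α) : Summable fun x => (μ x).toReal :=
  ENNReal.summable_toReal μ.tsum_coe_ne_top

lemma summable_toReal_mul {α : Type*} (μ : PMF α) {f : α → ℝ} {c : ℝ}
    (hf : ∀ x, |f x| ≤ c) : Summable fun x => (μ x).toReal * f x := by
  refine Summable.of_norm_bounded ((summable_toReal μ).mul_right c) fun x => ?_
  rw [Real.norm_eq_abs, abs_mul, abs_of_nonneg ENNReal.toReal_nonneg]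
  exact mul_le_mul_of_nonneg_left (hf x) ENNReal.toReal_nonneg

lemma tsum_toReal {α : Type*} (μ : PMF α) : ∑' x, (μ x).toReal = 1 := by
  rw [← ENNReal.tsum_toReal_eq fun x => μ.apply_ne_top x, μ.tsum_coe, ENNReal.toReal_one]

lemma abs_pexp_le {α : Type*} (μ : PMF α) {f : α → ℝ} {c : ℝ}
    (hf : ∀ x, |f x| ≤ c) : |pexp μ f| ≤ c := by
  have h := tsum_of_norm_bounded ((summable_toReal μ).mul_right c).hasSum
    (f := fun x => (μ x).toReal * f x) fun x => by
      rw [Real.norm_eq_abs, abs_mul, abs_of_nonneg ENNReal.toReal_nonneg]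
      exact mul_le_mul_of_nonneg_left (hf x) ENNReal.toReal_nonneg
  rwa [tsum_mul_right, tsum_toReal, one_mul] at h

lemma pexp_add_const {α : Type*} (μ : PMF α) {f : α → ℝ} {c : ℝ}
    (hf : ∀ x, |f x| ≤ c) :
    pexp μ f + c = (lexp μ fun x => ENNReal.ofReal (f x + c)).toReal := by
  rw [lexp, ENNReal.tsum_toReal_eq
    fun x => ENNReal.mul_ne_top (μ.apply_ne_top x) ENNReal.ofReal_ne_top]
  have h : ∀ x, (μ x * ENNReal.ofReal (f x + c)).toReal
      = (μ x).toReal * f x + (μ x).toReal * c := fun x => by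
    rw [ENNReal.toReal_mul, ENNReal.toReal_ofReal (by linarith [(abs_le.1 (hf x)).1]), mul_add]
  simp only [h]
  rw [(summable_toReal_mul μ hf).tsum_add ((summable_toReal μ).mul_right c), tsum_mul_right,
    tsum_toReal, one_mul, pexp]

section Trajectories

variable {S : Type*} {A : Type*}

/-- Expected value of `f` after one transition from the state-action pair `x`. -/
noncomputable def stepExp (π : S → PMF A) (P : S → A → PMF S) (f : S × A → ℝ≥0∞)
    (x : S × A) : ℝ≥0∞ :=
  lexp (P x.1 x.2) fun s' => lexp (π s') fun a' => f (s', a')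

/-- The trajectory prefix `p` does not visit `U` strictly before its last time. -/
def Avoids (U : Set (S × A)) {n : ℕ} (p : Fin (n + 1) → S × A) : Prop :=
  ∀ i : Fin (n + 1), (i : ℕ) < n → p i ∉ U

lemma avoids_snoc (U : Set (S × A)) {n : ℕ} (p : Fin (n + 1) → S × A) (x : S × A) :
    Avoids U (Fin.snoc p x : Fin (n + 2) → S × A) ↔ Avoids U p ∧ p (Fin.last n) ∉ U := by
  simp only [Avoids, Fin.forall_fin_succ' (n := n + 1), Fin.snoc_castSucc, Fin.val_castSucc,
    Fin.val_last, lt_irrefl, false_imp_iff, and_true]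
  constructor
  · exact fun h => ⟨fun i _ => h i i.2, h _ (Fin.last n).2⟩
  · rintro ⟨h, hl⟩ i -
    rcases Fin.eq_castSucc_or_eq_last i with ⟨j, rfl⟩ | rfl
    · exact h _ (by simp)
    · exact hl

/-- Expectation of `f (s_n, a_n)` restricted to trajectories avoiding `U` before time `n`. -/
noncomputable def avoidExp (ρ0 : PMF S) (π : S → PMF A) (P : S → A → PMF S)
    (U : Set (S × A)) (n : ℕ) (f : S × A → ℝ≥0∞) : ℝ≥0∞ :=
  lexp (pathPMF ρ0 π P n) fun p => if Avoids U p then f (p (Fin.last n)) else 0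

variable (ρ0 : PMF S) (π : S → PMF A) (P : S → A → PMF S) (U : Set (S × A))

lemma avoidExp_zero (f : S × A → ℝ≥0∞) :
    avoidExp ρ0 π P U 0 f = lexp ρ0 fun s => lexp (π s) fun a => f (s, a) := by
  simp [avoidExp, pathPMF, lexp_bind, lexp_map, Avoids]

lemma avoidExp_succ (n : ℕ) (f : S × A → ℝ≥0∞) :
    avoidExp ρ0 π P U (n + 1) f
      = avoidExp ρ0 π P U n fun x => if x ∈ U then 0 else stepExp π P f x := by
  simp only [avoidExp, pathPMF, lexp_bind, lexp_map, avoids_snoc, Fin.snoc_last]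
  congr 1
  funext p
  by_cases h1 : Avoids U p <;> by_cases h2 : p (Fin.last n) ∈ U <;> simp [h1, h2, stepExp, lexp_const]

lemma lexp_saDist (n : ℕ) (f : S × A → ℝ≥0∞) :
    lexp (saDist ρ0 π P n) f = lexp (pathPMF ρ0 π P n) fun p => f (p (Fin.last n)) := by
  rw [saDist, lexp_map]

lemma lexp_saDist_zero (f : S × A → ℝ≥0∞) :
    lexp (saDist ρ0 π P 0) f = lexp ρ0 fun s => lexp (π s) fun a => f (s, a) := by
  simp only [lexp_saDist, pathPMF, lexp_bind, lexp_map]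

lemma lexp_saDist_succ (n : ℕ) (f : S × A → ℝ≥0∞) :
    lexp (saDist ρ0 π P (n + 1)) f = lexp (saDist ρ0 π P n) (stepExp π P f) := by
  simp only [lexp_saDist, pathPMF, lexp_bind, lexp_map, Fin.snoc_last, stepExp]

lemma hitProb_eq (n : ℕ) :
    hitProb ρ0 π P U n = avoidExp ρ0 π P U n fun x => if x ∈ U then 1 else 0 := by
  rw [hitProb, PMF.toOuterMeasure_apply, avoidExp, lexp]
  congr 1
  funext p
  have hp : p ∈ {p : Fin (n + 1) → S × A |
      p (Fin.last n) ∈ U ∧ ∀ i : Fin (n + 1), (i : ℕ) < n → p i ∉ U}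
        ↔ p (Fin.last n) ∈ U ∧ Avoids U p := Iff.rfl
  rw [Set.indicator_apply]
  simp only [hp]
  by_cases h1 : Avoids U p <;> by_cases h2 : p (Fin.last n) ∈ U <;> simp [h1, h2]

lemma avoidExp_one_add_sum_hitProb (n : ℕ) :
    avoidExp ρ0 π P U n (fun _ => 1) + ∑ k ∈ Finset.range n, hitProb ρ0 π P U k = 1 := by
  induction n with
  | zero => simp [avoidExp_zero, lexp_const]
  | succ n ih =>
    rw [Finset.sum_range_succ, add_comm (Finset.sum _ _), ← add_assoc, avoidExp_succ,
      hitProb_eq ρ0 π P U n]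
    convert ih using 2
    rw [avoidExp, avoidExp, avoidExp, ← lexp_add]
    congr 1
    funext p
    by_cases h1 : Avoids U p <;> by_cases h2 : p (Fin.last n) ∈ U <;>
      simp [h1, h2, stepExp, lexp_const]

lemma lexp_saDist_pess (a0 : PMF A) (n : ℕ) (g : Option S × A → ℝ≥0∞)
    (hg : ∀ a, g (none, a) = 0) :
    lexp (saDist (ρ0.map some) (extendPolicy π a0) (pessKernel P U) n) g
      = avoidExp ρ0 π P U n fun x => g (some x.1, x.2) := by
  induction n generalizing g with
  | zero => simp only [lexp_saDist_zero, lexp_map, avoidExp_zero, extendPolicy]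
  | succ n ih =>
    have hn : lexp a0 (fun a => g (none, a)) = 0 := by simp only [hg, lexp_const]
    rw [lexp_saDist_succ, ih, avoidExp_succ]
    · congr 1
      funext x
      by_cases hx : x ∈ U
      · simp [stepExp, pessKernel, hx, lexp_pure, extendPolicy, hn]
      · simp [stepExp, pessKernel, hx, lexp_map, extendPolicy]
    · intro a
      simp [stepExp, pessKernel, lexp_pure, extendPolicy, hn]

lemma lexp_saDist_le (n : ℕ) {f : S × A → ℝ≥0∞} {c : ℝ≥0∞} (hf : ∀ x, f x ≤ c) :
    lexp (saDist ρ0 π P n) f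
      ≤ avoidExp ρ0 π P U n f + c * ∑ k ∈ Finset.range n, hitProb ρ0 π P U k := by
  have hone : avoidExp ρ0 π P U n (fun _ => 1)
      + lexp (pathPMF ρ0 π P n) (fun p => if Avoids U p then 0 else 1) = 1 := by
    rw [avoidExp, ← lexp_add, ← lexp_const (pathPMF ρ0 π P n) 1]
    congr 1
    funext p
    split_ifs <;> simp [lexp_const]
  have hne : avoidExp ρ0 π P U n (fun _ => 1) ≠ ∞ := fun h => by simp [h] at hone
  have hsum : ∑ k ∈ Finset.range n, hitProb ρ0 π P U k
      = lexp (pathPMF ρ0 π P n) (fun p => if Avoids U p then 0 else 1) :=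
    (ENNReal.add_right_inj hne).1
      ((avoidExp_one_add_sum_hitProb ρ0 π P U n).trans hone.symm)
  rw [hsum, ← lexp_const_mul, avoidExp, ← lexp_add, lexp_saDist]
  refine lexp_mono _ fun p => ?_
  split_ifs
  · simp
  · simpa using hf _

lemma sum_hitProb_le_one (n : ℕ) : ∑ k ∈ Finset.range n, hitProb ρ0 π P U k ≤ 1 :=
  le_add_self.trans (avoidExp_one_add_sum_hitProb ρ0 π P U n).le

lemma hitProb_le_one (n : ℕ) : hitProb ρ0 π P U n ≤ 1 :=
  (Finset.single_le_sum (fun _ _ => zero_le) (Finset.self_mem_range_succ n)).trans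
    (sum_hitProb_le_one ρ0 π P U (n + 1))

lemma pexp_saDist_le (a0 : PMF A) (r : S → A → ℝ) {c : ℝ} (hc : 0 ≤ c)
    (hr : ∀ s a, |r s a| ≤ c) (n : ℕ) :
    pexp (saDist ρ0 π P n) (fun x => r x.1 x.2)
      ≤ pexp (saDist (ρ0.map some) (extendPolicy π a0) (pessKernel P U) n)
          (fun x => pessReward r c x.1 x.2)
        + 2 * c * ∑ k ∈ Finset.range n, (hitProb ρ0 π P U k).toReal := by
  have hrp : ∀ x : Option S × A, |pessReward r c x.1 x.2| ≤ c := by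
    rintro ⟨_ | s, a⟩
    · simp [pessReward, abs_of_nonneg hc]
    · exact hr s a
  have h1 := pexp_add_const (saDist ρ0 π P n) (f := fun x => r x.1 x.2) fun x => hr x.1 x.2
  have h2 := pexp_add_const
    (saDist (ρ0.map some) (extendPolicy π a0) (pessKernel P U) n) hrp
  have hp := lexp_saDist_pess ρ0 π P U a0 n
    (fun x => ENNReal.ofReal (pessReward r c x.1 x.2 + c)) (by simp [pessReward])
  rw [hp] at h2
  have hle : ∀ x : S × A, ENNReal.ofReal (r x.1 x.2 + c) ≤ ENNReal.ofReal (2 * c) := fun x =>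
    ENNReal.ofReal_le_ofReal (by linarith [(abs_le.1 (hr x.1 x.2)).2])
  have hs : ∑ k ∈ Finset.range n, hitProb ρ0 π P U k ≠ ∞ :=
    ((sum_hitProb_le_one ρ0 π P U n).trans_lt ENNReal.one_lt_top).ne
  have hfin : avoidExp ρ0 π P U n (fun x => ENNReal.ofReal (r x.1 x.2 + c)) ≠ ∞ := by
    refine ((lexp_mono _ fun p => ?_).trans_lt
      ((lexp_const _ (ENNReal.ofReal (2 * c))).trans_lt ENNReal.ofReal_lt_top)).ne
    split_ifs
    · exact hle _
    · exact zero_le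
  have h := ENNReal.toReal_mono
    (ENNReal.add_ne_top.2 ⟨hfin, ENNReal.mul_ne_top ENNReal.ofReal_ne_top hs⟩)
    (lexp_saDist_le ρ0 π P U n hle)
  rw [ENNReal.toReal_add hfin (ENNReal.mul_ne_top ENNReal.ofReal_ne_top hs), ENNReal.toReal_mul,
    ENNReal.toReal_ofReal (by positivity), ENNReal.toReal_sum
      fun k _ => ((hitProb_le_one ρ0 π P U k).trans_lt ENNReal.one_lt_top).ne, ← h1] at h
  simp only [pessReward] at h2 ⊢
  linarith

end Trajectories

lemma summable_pow_mul_of_abs_le {γ : ℝ} (hγ0 : 0 ≤ γ) (hγ1 : γ < 1) {f : ℕ → ℝ} {c : ℝ}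
    (hf : ∀ n, |f n| ≤ c) : Summable fun n => γ ^ n * f n := by
  refine Summable.of_norm_bounded ((summable_geometric_of_lt_one hγ0 hγ1).mul_right c)
    fun n => ?_
  rw [Real.norm_eq_abs, abs_mul, abs_of_nonneg (pow_nonneg hγ0 n)]
  exact mul_le_mul_of_nonneg_left (hf n) (pow_nonneg hγ0 n)

lemma tsum_pow_mul_sum_range {γ : ℝ} {h : ℕ → ℝ}
    (hh : Summable fun n => γ ^ n * h n)
    (hH : Summable fun n => γ ^ n * ∑ k ∈ Finset.range n, h k) :
    (1 - γ) * ∑' n, γ ^ n * ∑ k ∈ Finset.range n, h k = γ * ∑' n, γ ^ n * h n := by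
  have key := hH.tsum_eq_zero_add
  have e : ∀ n, γ ^ (n + 1) * ∑ k ∈ Finset.range (n + 1), h k
      = γ * (γ ^ n * ∑ k ∈ Finset.range n, h k) + γ * (γ ^ n * h n) := fun n => by
    rw [Finset.sum_range_succ]; ring
  simp only [e, Finset.range_zero, Finset.sum_empty, mul_zero, zero_add] at key
  rw [(hH.mul_left γ).tsum_add (hh.mul_left γ), tsum_mul_left, tsum_mul_left] at key
  linarith

/-- **Step in the proof of Theorem 1.** The true-dynamics pessimistic MDP built from an
arbitrary set `U` of state-action pairs lower-bounds the true value up to the discounted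
hitting time of `U`. -/
theorem true_pessimistic_lower_bound
    {S : Type u} {A : Type v} [Countable S] [Countable A]
    (P : S → A → PMF S) (ρ0 : PMF S)
    (r : S → A → ℝ) (Rmax : ℝ) (hR : ∀ s a, |r s a| ≤ Rmax)
    (γ : ℝ) (hγ0 : 0 ≤ γ) (hγ1 : γ < 1)
    (U : Set (S × A))
    (π : S → PMF A) (a0 : PMF A) :
    J ρ0 π P γ r - (2 * Rmax / (1 - γ)) * discHit ρ0 π P γ U
      ≤ J (ρ0.map some) (extendPolicy π a0) (pessKernel P U) γ (pessReward r Rmax) := by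
  obtain ⟨s, -⟩ := ρ0.support_nonempty
  obtain ⟨a, -⟩ := a0.support_nonempty
  have hc : 0 ≤ Rmax := (abs_nonneg _).trans (hR s a)
  have hrp : ∀ x : Option S × A, |pessReward r Rmax x.1 x.2| ≤ Rmax := by
    rintro ⟨_ | s, a⟩
    · simp [pessReward, abs_of_nonneg hc]
    · exact hR s a
  have htop : ∀ k, hitProb ρ0 π P U k ≠ ∞ := fun k =>
    ((hitProb_le_one ρ0 π P U k).trans_lt ENNReal.one_lt_top).ne
  have sT := summable_pow_mul_of_abs_le hγ0 hγ1
    fun n => abs_pexp_le (saDist ρ0 π P n) (f := fun x => r x.1 x.2) fun x => hR x.1 x.2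
  have sP := summable_pow_mul_of_abs_le hγ0 hγ1 fun n =>
    abs_pexp_le (saDist (ρ0.map some) (extendPolicy π a0) (pessKernel P U) n) hrp
  have sh : Summable fun n => γ ^ n * (hitProb ρ0 π P U n).toReal :=
    summable_pow_mul_of_abs_le hγ0 hγ1 (c := 1) fun n => by
      rw [abs_of_nonneg ENNReal.toReal_nonneg]
      exact ENNReal.toReal_le_of_le_ofReal zero_le_one (by simpa using hitProb_le_one ρ0 π P U n)
  have sH : Summable fun n => γ ^ n * ∑ k ∈ Finset.range n, (hitProb ρ0 π P U k).toReal :=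
    summable_pow_mul_of_abs_le hγ0 hγ1 (c := 1) fun n => by
      rw [← ENNReal.toReal_sum fun k _ => htop k, abs_of_nonneg ENNReal.toReal_nonneg]
      exact ENNReal.toReal_le_of_le_ofReal zero_le_one
        (by simpa using sum_hitProb_le_one ρ0 π P U n)
  have hle := sT.tsum_le_tsum (fun n => (mul_le_mul_of_nonneg_left
    (pexp_saDist_le ρ0 π P U a0 r hc hR n) (pow_nonneg hγ0 n)).trans_eq
      (by rw [mul_add, mul_left_comm])) (sP.add (sH.mul_left (2 * Rmax)))
  rw [sP.tsum_add (sH.mul_left (2 * Rmax)), tsum_mul_left] at hle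
  have hgeo := tsum_pow_mul_sum_range sh sH
  have hD : 0 ≤ discHit ρ0 π P γ U :=
    tsum_nonneg fun n => mul_nonneg (pow_nonneg hγ0 n) ENNReal.toReal_nonneg
  have hpos : 0 < 1 - γ := sub_pos.2 hγ1
  have hbound : ∑' n, γ ^ n * ∑ k ∈ Finset.range n, (hitProb ρ0 π P U k).toReal
      ≤ discHit ρ0 π P γ U / (1 - γ) := by
    rw [le_div_iff₀ hpos, mul_comm, hgeo]
    exact mul_le_of_le_one_left hD hγ1.le
  have hfinal := mul_le_mul_of_nonneg_left hbound (mul_nonneg zero_le_two hc)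
  rw [← mul_div_assoc, mul_div_right_comm] at hfinal
  rw [sub_le_iff_le_add]
  exact hle.trans (by simpa only [J] using add_le_add_right hfinal _)

end MOReL
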